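/- Let w : ℝ³ → ℝ be smooth with Δ_b(Δ_b w) = 0 on all of ℍ¹, and suppose that limsup of Δ_b w at infinity is at most 0, i.e. for every ε > 0 there is R > 0 such that Δ_b w(p) ≤ ε whenever ρ(p) > R. Then Δ_b w is constant on ℍ¹, and this constant is ≤ 0. -/

import Mathlib

open MeasureTheory Real

noncomputable section

/-- The Heisenberg group `ℍ¹` as `ℝ³` with coordinates `(x, y, t)`. -/
abbrev Heis : Type := ℝ × ℝ × ℝ

/-- Group law `(z,t)·(z',t') = (z+z', t+t'+2 Im(z ⬝ conj z'))`. -/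
def Hmul (p q : Heis) : Heis :=
  (p.1 + q.1, p.2.1 + q.2.1, p.2.2 + q.2.2 + 2 * (p.2.1 * q.1 - p.1 * q.2.1))

/-- Group inverse `(z,t)⁻¹ = (-z,-t)`. -/
def Hinv (p : Heis) : Heis := (-p.1, -p.2.1, -p.2.2)

/-- Korányi norm `ρ(z,t) = (|z|⁴ + t²)^(1/4)`. -/
def rho (p : Heis) : ℝ := ((p.1 ^ 2 + p.2.1 ^ 2) ^ 2 + p.2.2 ^ 2) ^ ((1 : ℝ) / 4)

/-- Korányi ball `B(p,r) = {q : ρ(p⁻¹ q) < r}`. -/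
def Kball (p : Heis) (r : ℝ) : Set Heis := {q | rho (Hmul (Hinv p) q) < r}

/-- The left-invariant vector field `X = ∂ₓ + 2y ∂_t` acting on a function. -/
def Xd (f : Heis → ℝ) (p : Heis) : ℝ := fderiv ℝ f p (1, 0, 2 * p.2.1)

/-- The left-invariant vector field `Y = ∂_y − 2x ∂_t` acting on a function. -/
def Yd (f : Heis → ℝ) (p : Heis) : ℝ := fderiv ℝ f p (0, 1, -(2 * p.1))

/-- The vector field `T = ∂_t`. -/
def Td (f : Heis → ℝ) (p : Heis) : ℝ := fderiv ℝ f p (0, 0, 1)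

/-- Sub-Laplacian `Δ_b = X² + Y²`. -/
def subLap (f : Heis → ℝ) : Heis → ℝ := fun p => Xd (Xd f) p + Yd (Yd f) p

/-- Squared length of the horizontal gradient: `|∇_b f|² = (Xf)² + (Yf)²`. -/
def gradb2 (f : Heis → ℝ) (p : Heis) : ℝ := (Xd f p) ^ 2 + (Yd f p) ^ 2

/-- The group translate by `p` of the anisotropic dilation of `q` by the factor `r`. -/
def dilTrans (p : Heis) (r : ℝ) (q : Heis) : Heis :=
  (p.1 + r * q.1, p.2.1 + r * q.2.1,
    p.2.2 + r ^ 2 * q.2.2 + 2 * r * (p.2.1 * q.1 - p.1 * q.2.1))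

/-- The fourth power of the Korányi norm. -/
def koranyi4 (q : Heis) : ℝ := (q.1 ^ 2 + q.2.1 ^ 2) ^ 2 + q.2.2 ^ 2

/-- The truncated power `(R - ρ⁴)₊ ^ n`. -/
def cutoff (R : ℝ) (n : ℕ) (q : Heis) : ℝ := max 0 (R - koranyi4 q) ^ n

/-- The unnormalised mean value kernel `|z|² (R - ρ⁴)₊ ^ 3`. -/
def meanKernel (R : ℝ) (q : Heis) : ℝ := (q.1 ^ 2 + q.2.1 ^ 2) * cutoff R 3 q

lemma fderiv_coords (f : Heis → ℝ) (p : Heis) (a b c : ℝ) :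
    fderiv ℝ f p (a, b, c) =
      a * fderiv ℝ f p (1, 0, 0) + b * fderiv ℝ f p (0, 1, 0) + c * fderiv ℝ f p (0, 0, 1) := by
  have h : ((a, b, c) : Heis) = a • (1, 0, 0) + b • (0, 1, 0) + c • (0, 0, 1) := by simp
  rw [h, map_add, map_add, map_smul, map_smul, map_smul]
  simp

lemma contDiff_dilTrans (p : Heis) (r : ℝ) : ContDiff ℝ (⊤ : ℕ∞) (dilTrans p r) := by
  unfold dilTrans; fun_prop

lemma hasFDerivAt_dilTrans (p : Heis) (r : ℝ) (q : Heis) :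
    ∃ L : Heis →L[ℝ] Heis, HasFDerivAt (dilTrans p r) L q ∧ ∀ v : Heis,
      L v = (r * v.1, r * v.2.1, r ^ 2 * v.2.2 + 2 * r * (p.2.1 * v.1 - p.1 * v.2.1)) := by
  have h1 : HasFDerivAt (fun q : Heis => q.1) (ContinuousLinearMap.fst ℝ ℝ (ℝ × ℝ)) q :=
    hasFDerivAt_fst
  have h2 : HasFDerivAt (fun q : Heis => q.2) (ContinuousLinearMap.snd ℝ ℝ (ℝ × ℝ)) q :=
    hasFDerivAt_snd
  refine ⟨_, ((h1.const_mul r).const_add p.1).prodMk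
    (((h2.fst.const_mul r).const_add p.2.1).prodMk
      (((h2.snd.const_mul (r ^ 2)).const_add p.2.2).add
        (((h1.const_mul p.2.1).sub (h2.fst.const_mul p.1)).const_mul (2 * r)))), fun v => ?_⟩
  simp

lemma fderiv_comp_dilTrans {f : Heis → ℝ} (hf : Differentiable ℝ f) (p : Heis) (r : ℝ)
    (q v : Heis) :
    fderiv ℝ (fun q => f (dilTrans p r q)) q v = fderiv ℝ f (dilTrans p r q)
      (r * v.1, r * v.2.1, r ^ 2 * v.2.2 + 2 * r * (p.2.1 * v.1 - p.1 * v.2.1)) := by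
  obtain ⟨L, hL, hLv⟩ := hasFDerivAt_dilTrans p r q
  have := ((hf (dilTrans p r q)).hasFDerivAt.comp q hL).fderiv
  rw [← hLv]
  exact congrArg (fun T : Heis →L[ℝ] ℝ => T v) this

lemma Xd_comp_dilTrans {f : Heis → ℝ} (hf : Differentiable ℝ f) (p : Heis) (r : ℝ) :
    Xd (fun q => f (dilTrans p r q)) = fun q => r * Xd f (dilTrans p r q) := by
  funext q
  simp only [Xd]
  rw [fderiv_comp_dilTrans hf, fderiv_coords, fderiv_coords f _ 1 0 (2 * (dilTrans p r q).2.1)]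
  simp only [dilTrans]
  ring

lemma Yd_comp_dilTrans {f : Heis → ℝ} (hf : Differentiable ℝ f) (p : Heis) (r : ℝ) :
    Yd (fun q => f (dilTrans p r q)) = fun q => r * Yd f (dilTrans p r q) := by
  funext q
  simp only [Yd]
  rw [fderiv_comp_dilTrans hf, fderiv_coords, fderiv_coords f _ 0 1 (-(2 * (dilTrans p r q).1))]
  simp only [dilTrans]
  ring

lemma Xd_const_mul (c : ℝ) (f : Heis → ℝ) (p : Heis) :
    Xd (fun q => c * f q) p = c * Xd f p := by
  simp only [Xd]
  rw [show (fun q => c * f q) = c • f from rfl, fderiv_const_smul_field]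
  simp

lemma Yd_const_mul (c : ℝ) (f : Heis → ℝ) (p : Heis) :
    Yd (fun q => c * f q) p = c * Yd f p := by
  simp only [Yd]
  rw [show (fun q => c * f q) = c • f from rfl, fderiv_const_smul_field]
  simp

lemma contDiff_Xd {f : Heis → ℝ} (hf : ContDiff ℝ (⊤ : ℕ∞) f) : ContDiff ℝ (⊤ : ℕ∞) (Xd f) := by
  have h : ContDiff ℝ (⊤ : ℕ∞) (fderiv ℝ f) := hf.fderiv_right (by simp)
  exact h.clm_apply (by fun_prop)

lemma contDiff_Yd {f : Heis → ℝ} (hf : ContDiff ℝ (⊤ : ℕ∞) f) : ContDiff ℝ (⊤ : ℕ∞) (Yd f) := by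
  have h : ContDiff ℝ (⊤ : ℕ∞) (fderiv ℝ f) := hf.fderiv_right (by simp)
  exact h.clm_apply (by fun_prop)

lemma contDiff_subLap {f : Heis → ℝ} (hf : ContDiff ℝ (⊤ : ℕ∞) f) :
    ContDiff ℝ (⊤ : ℕ∞) (subLap f) :=
  (contDiff_Xd (contDiff_Xd hf)).add (contDiff_Yd (contDiff_Yd hf))

lemma subLap_comp_dilTrans {f : Heis → ℝ} (hf : ContDiff ℝ (⊤ : ℕ∞) f) (p : Heis) (r : ℝ)
    (q : Heis) :
    subLap (fun q => f (dilTrans p r q)) q = r ^ 2 * subLap f (dilTrans p r q) := by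
  simp only [subLap]
  rw [Xd_comp_dilTrans (hf.differentiable (by simp)), Xd_const_mul,
    Xd_comp_dilTrans ((contDiff_Xd hf).differentiable (by simp)),
    Yd_comp_dilTrans (hf.differentiable (by simp)), Yd_const_mul,
    Yd_comp_dilTrans ((contDiff_Yd hf).differentiable (by simp))]
  ring

lemma hasDerivAt_max_zero_pow (n : ℕ) (s : ℝ) :
    HasDerivAt (fun s : ℝ => max 0 s ^ (n + 2)) ((n + 2) * max 0 s ^ (n + 1)) s := by
  rcases lt_trichotomy s 0 with h | rfl | h
  · rw [max_eq_left h.le]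
    simp only [ne_eq, Nat.add_eq_zero_iff, one_ne_zero, and_false, not_false_eq_true, zero_pow,
      mul_zero]
    refine (hasDerivAt_const s (0 : ℝ)).congr_of_eventuallyEq ?_
    filter_upwards [eventually_lt_nhds h] with x hx
    simp [max_eq_left hx.le]
  · simp only [max_self, ne_eq, Nat.add_eq_zero_iff, one_ne_zero, and_false, not_false_eq_true,
      zero_pow, mul_zero]
    rw [hasDerivAt_iff_isLittleO_nhds_zero]
    simp only [zero_add, max_self, smul_zero, sub_zero]
    have h1 : (fun x : ℝ => max 0 x ^ (n + 2)) =O[nhds 0] fun x => x ^ (n + 2) := by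
      refine Asymptotics.IsBigO.of_bound 1 (Filter.Eventually.of_forall fun x => ?_)
      rw [one_mul, norm_pow, norm_pow]
      refine pow_le_pow_left₀ (norm_nonneg _) ?_ _
      rw [Real.norm_eq_abs, Real.norm_eq_abs, abs_of_nonneg (le_max_left _ _)]
      exact max_le (abs_nonneg x) (le_abs_self x)
    have h2 : (fun x : ℝ => x ^ (n + 2)) =o[nhds 0] fun x => x := by
      simpa using Asymptotics.isLittleO_pow_id (𝕜 := ℝ) (n := n + 2) (by omega)
    simpa using h1.trans_isLittleO h2
  · rw [max_eq_right h.le]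
    have := hasDerivAt_pow (n + 2) s
    refine HasDerivAt.congr_of_eventuallyEq (f := fun x => x ^ (n + 2)) (by simpa using this) ?_
    filter_upwards [eventually_gt_nhds h] with x hx
    simp [max_eq_right hx.le]

lemma continuous_koranyi4 : Continuous koranyi4 := by unfold koranyi4; fun_prop

lemma contDiff_koranyi4 : ContDiff ℝ 1 koranyi4 := by unfold koranyi4; fun_prop

lemma continuous_cutoff (R : ℝ) (n : ℕ) : Continuous (cutoff R n) := by
  have := continuous_koranyi4
  unfold cutoff; fun_prop

lemma contDiff_cutoff (R : ℝ) (n : ℕ) : ContDiff ℝ 1 (cutoff R (n + 2)) := by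
  have h : ContDiff ℝ 1 (fun s : ℝ => max 0 s ^ (n + 2)) := by
    rw [contDiff_one_iff_deriv]
    refine ⟨fun s => (hasDerivAt_max_zero_pow n s).differentiableAt, ?_⟩
    rw [funext fun s => (hasDerivAt_max_zero_pow n s).deriv]
    fun_prop
  exact h.comp (contDiff_const.sub contDiff_koranyi4)

lemma fderiv_koranyi4 (q v : Heis) :
    fderiv ℝ koranyi4 q v = 4 * (q.1 ^ 2 + q.2.1 ^ 2) * (q.1 * v.1 + q.2.1 * v.2.1)
      + 2 * q.2.2 * v.2.2 := by
  have h1 : HasFDerivAt (fun q : Heis => q.1) (ContinuousLinearMap.fst ℝ ℝ (ℝ × ℝ)) q :=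
    hasFDerivAt_fst
  have h2 : HasFDerivAt (fun q : Heis => q.2) (ContinuousLinearMap.snd ℝ ℝ (ℝ × ℝ)) q :=
    hasFDerivAt_snd
  have h := ((((h1.pow 2).add (h2.fst.pow 2)).pow 2).add (h2.snd.pow 2)).fderiv
  have h' := congrArg (fun T : Heis →L[ℝ] ℝ => T v) h
  refine Eq.trans h' ?_
  simp
  ring

lemma fderiv_cutoff (R : ℝ) (n : ℕ) (q v : Heis) :
    fderiv ℝ (cutoff R (n + 2)) q v =
      -((n + 2) * cutoff R (n + 1) q * fderiv ℝ koranyi4 q v) := by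
  have h := (hasDerivAt_max_zero_pow n (R - koranyi4 q)).comp_hasFDerivAt q
    (((contDiff_koranyi4.differentiable (by simp)) q).hasFDerivAt.const_sub R)
  have h' := congrArg (fun T : Heis →L[ℝ] ℝ => T v) h.fderiv
  refine Eq.trans h' ?_
  simp [cutoff]

lemma norm_le_of_koranyi4_le {R : ℝ} (hR : 1 ≤ R) {q : Heis} (h : koranyi4 q ≤ R) : ‖q‖ ≤ R := by
  have h' : (q.1 ^ 2 + q.2.1 ^ 2) ^ 2 + q.2.2 ^ 2 ≤ R := h
  have hz : q.1 ^ 2 + q.2.1 ^ 2 ≤ R := by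
    by_contra! hc
    nlinarith [sq_nonneg q.2.2]
  simp only [Prod.norm_def, Real.norm_eq_abs, max_le_iff]
  refine ⟨abs_le_of_sq_le_sq ?_ (by linarith), abs_le_of_sq_le_sq ?_ (by linarith),
    abs_le_of_sq_le_sq ?_ (by linarith)⟩ <;>
  nlinarith [sq_nonneg q.1, sq_nonneg q.2.1, sq_nonneg (q.1 ^ 2 + q.2.1 ^ 2)]

lemma isCompact_koranyi4_le (R : ℝ) : IsCompact {q : Heis | koranyi4 q ≤ R} := by
  refine (isCompact_closedBall (0 : Heis) (max R 1)).of_isClosed_subset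
    (isClosed_le continuous_koranyi4 continuous_const) fun q hq => ?_
  rw [mem_closedBall_zero_iff]
  exact norm_le_of_koranyi4_le (le_max_right _ _) (hq.trans (le_max_left _ _))

lemma hasCompactSupport_cutoff (R : ℝ) (n : ℕ) : HasCompactSupport (cutoff R (n + 1)) := by
  refine HasCompactSupport.intro (isCompact_koranyi4_le R) fun q hq => ?_
  have : R < koranyi4 q := not_le.mp hq
  simp [cutoff, max_eq_left (sub_nonpos.mpr this.le)]

lemma continuous_meanKernel (R : ℝ) : Continuous (meanKernel R) := by
  have := continuous_cutoff R 3
  unfold meanKernel; fun_prop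

lemma hasCompactSupport_meanKernel (R : ℝ) : HasCompactSupport (meanKernel R) :=
  (hasCompactSupport_cutoff R 2).mul_left

lemma meanKernel_nonneg (R : ℝ) (q : Heis) : 0 ≤ meanKernel R q := by
  unfold meanKernel cutoff; positivity

instance isAddHaarMeasure_volume_heis : (volume : Measure Heis).IsAddHaarMeasure :=
  Measure.prod.instIsAddHaarMeasure volume volume

lemma integral_fderiv_eq_zero {f : Heis → ℝ} (hf : ContDiff ℝ 1 f) (hc : HasCompactSupport f)
    (v : Heis) : ∫ q, fderiv ℝ f q v = 0 := by
  have hd : Continuous fun q => fderiv ℝ f q v :=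
    (hf.continuous_fderiv (by simp)).clm_apply continuous_const
  have h := integral_mul_fderiv_eq_neg_fderiv_mul_of_integrable (μ := (volume : Measure Heis))
    (f := fun _ : Heis => (1 : ℝ)) (g := f) (v := v) (by simp)
    (by simpa using hd.integrable_of_hasCompactSupport (hc.fderiv_apply (𝕜 := ℝ) v))
    (by simpa using hf.continuous.integrable_of_hasCompactSupport hc)
    (by simp) (fun q _ => hf.differentiable (by simp) q)
  simpa using h

lemma integral_meanKernel_mul_euler {R : ℝ} {v : Heis → ℝ} (hv : ContDiff ℝ (⊤ : ℕ∞) v)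
    (hh : ∀ q, subLap v q = 0) :
    ∫ q, fderiv ℝ v q (q.1, q.2.1, 2 * q.2.2) * meanKernel R q = 0 := by
  have hv1 : ContDiff ℝ 1 v := hv.of_le (by simp)
  have hP : ContDiff ℝ 1 (Xd v) := (contDiff_Xd hv).of_le (by simp)
  have hQ : ContDiff ℝ 1 (Yd v) := (contDiff_Yd hv).of_le (by simp)
  have h3 : ContDiff ℝ 1 (cutoff R 3) := contDiff_cutoff R 1
  have h4 : ContDiff ℝ 1 (cutoff R 4) := contDiff_cutoff R 2
  have hc3 : HasCompactSupport (cutoff R 3) := hasCompactSupport_cutoff R 2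
  have hc4 : HasCompactSupport (cutoff R 4) := hasCompactSupport_cutoff R 3
  set A : Heis → ℝ := fun q =>
    -(q.2.2 * q.2.1 * v q * cutoff R 3 q) - 1 / 16 * Xd v q * cutoff R 4 q with hA
  set B : Heis → ℝ := fun q =>
    q.2.2 * q.1 * v q * cutoff R 3 q - 1 / 16 * Yd v q * cutoff R 4 q with hB
  set C : Heis → ℝ := fun q =>
    -(1 / 8 * (q.2.1 * Xd v q - q.1 * Yd v q) * cutoff R 4 q) with hC
  have hA1 : ContDiff ℝ 1 A := by fun_prop
  have hB1 : ContDiff ℝ 1 B := by fun_prop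
  have hC1 : ContDiff ℝ 1 C := by fun_prop
  have hAc : HasCompactSupport A := hc3.mul_left.neg.sub hc4.mul_left
  have hBc : HasCompactSupport B := hc3.mul_left.sub hc4.mul_left
  have hCc : HasCompactSupport C := hc4.mul_left.neg
  have hint : ∀ {f : Heis → ℝ}, ContDiff ℝ 1 f → HasCompactSupport f → ∀ w : Heis,
      Integrable fun q => fderiv ℝ f q w := fun hf hc w =>
    ((hf.continuous_fderiv (by simp)).clm_apply continuous_const).integrable_of_hasCompactSupport
      (hc.fderiv_apply (𝕜 := ℝ) w)
  have key : ∀ q, fderiv ℝ v q (q.1, q.2.1, 2 * q.2.2) * meanKernel R q =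
      fderiv ℝ A q (1, 0, 0) + fderiv ℝ B q (0, 1, 0) + fderiv ℝ C q (0, 0, 1) := by
    intro q
    have d1 : HasFDerivAt (fun q : Heis => q.1) (ContinuousLinearMap.fst ℝ ℝ (ℝ × ℝ)) q :=
      hasFDerivAt_fst
    have d2' : HasFDerivAt (fun q : Heis => q.2) (ContinuousLinearMap.snd ℝ ℝ (ℝ × ℝ)) q :=
      hasFDerivAt_snd
    have d2 := d2'.fst
    have d3 := d2'.snd
    have dv := (hv1.differentiable (by simp) q).hasFDerivAt
    have dP := (hP.differentiable (by simp) q).hasFDerivAt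
    have dQ := (hQ.differentiable (by simp) q).hasFDerivAt
    have dh3 := (h3.differentiable (by simp) q).hasFDerivAt
    have dh4 := (h4.differentiable (by simp) q).hasFDerivAt
    have dA : HasFDerivAt A _ q :=
      ((((d3.mul d2).mul dv).mul dh3).neg).sub ((dP.const_mul (1 / 16)).mul dh4)
    have dB : HasFDerivAt B _ q :=
      (((d3.mul d1).mul dv).mul dh3).sub ((dQ.const_mul (1 / 16)).mul dh4)
    have dC : HasFDerivAt C _ q :=
      ((((d2.mul dP).sub (d1.mul dQ)).const_mul (1 / 8)).mul dh4).neg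
    have e3 : ∀ w, fderiv ℝ (cutoff R 3) q w = -(3 * cutoff R 2 q * fderiv ℝ koranyi4 q w) := by
      intro w; have := fderiv_cutoff R 1 q w; norm_num at this; exact this
    have e4 : ∀ w, fderiv ℝ (cutoff R 4) q w = -(4 * cutoff R 3 q * fderiv ℝ koranyi4 q w) := by
      intro w; have := fderiv_cutoff R 2 q w; norm_num at this; exact this
    have hL : fderiv ℝ (Xd v) q (1, 0, 2 * q.2.1) + fderiv ℝ (Yd v) q (0, 1, -(2 * q.1)) = 0 :=
      hh q
    rw [fderiv_coords, fderiv_coords (Yd v)] at hL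
    have hPq : Xd v q = fderiv ℝ v q (1, 0, 2 * q.2.1) := rfl
    have hQq : Yd v q = fderiv ℝ v q (0, 1, -(2 * q.1)) := rfl
    rw [fderiv_coords] at hPq hQq
    rw [dA.fderiv, dB.fderiv, dC.fderiv, fderiv_coords v q q.1]
    simp only [add_apply, sub_apply, neg_apply, smul_apply, smul_eq_mul, Pi.mul_apply,
      Pi.sub_apply,
      ContinuousLinearMap.comp_apply, ContinuousLinearMap.coe_fst', ContinuousLinearMap.coe_snd',
      e3, e4, fderiv_koranyi4, meanKernel]
    rw [hPq, hQq]
    linear_combination (1 / 16 * cutoff R 4 q) * hL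
  simp_rw [key]
  refine (integral_add ((hint hA1 hAc _).add (hint hB1 hBc _)) (hint hC1 hCc _)).trans ?_
  simp only [Pi.add_apply]
  rw [integral_add (hint hA1 hAc _) (hint hB1 hBc _), integral_fderiv_eq_zero hA1 hAc,
    integral_fderiv_eq_zero hB1 hBc, integral_fderiv_eq_zero hC1 hCc]
  simp

lemma hasDerivAt_integral_dilTrans {R : ℝ} {v : Heis → ℝ} (hv : ContDiff ℝ (⊤ : ℕ∞) v)
    (p : Heis) (r : ℝ) :
    HasDerivAt (fun r => ∫ q, v (dilTrans p r q) * meanKernel R q)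
      (∫ q, fderiv ℝ v (dilTrans p r q)
        (q.1, q.2.1, 2 * r * q.2.2 + 2 * (p.2.1 * q.1 - p.1 * q.2.1)) * meanKernel R q) r := by
  set D : ℝ × Heis → ℝ := fun x => fderiv ℝ v (dilTrans p x.1 x.2)
    (x.2.1, x.2.2.1, 2 * x.1 * x.2.2.2 + 2 * (p.2.1 * x.2.1 - p.1 * x.2.2.1)) with hD
  have hDc : Continuous D := by
    have h1 : Continuous (fderiv ℝ v) := hv.continuous_fderiv (by simp)
    have h2 : Continuous fun x : ℝ × Heis => dilTrans p x.1 x.2 := by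
      unfold dilTrans; fun_prop
    exact (h1.comp h2).clm_apply (by fun_prop)
  obtain ⟨C, hC⟩ := ((isCompact_closedBall r 1).prod
    (isCompact_koranyi4_le R)).exists_bound_of_continuousOn hDc.continuousOn
  have hk := continuous_meanKernel R
  have hkc := hasCompactSupport_meanKernel R
  have hF : ∀ s, Continuous fun q => v (dilTrans p s q) * meanKernel R q := fun s =>
    (hv.continuous.comp (contDiff_dilTrans p s).continuous).mul hk
  have hF' : ∀ s, Continuous fun q => D (s, q) * meanKernel R q := fun s =>
    (hDc.comp (by fun_prop)).mul hk
  refine (hasDerivAt_integral_of_dominated_loc_of_deriv_le (s := Metric.closedBall r 1)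
    (F' := fun s q => D (s, q) * meanKernel R q)
    (bound := fun q => C * meanKernel R q)
    (Metric.closedBall_mem_nhds r one_pos)
    (Filter.Eventually.of_forall fun s => (hF s).aestronglyMeasurable)
    ((hF r).integrable_of_hasCompactSupport hkc.mul_left)
    (hF' r).aestronglyMeasurable (Filter.Eventually.of_forall fun q s hs => ?_)
    ((continuous_const.mul hk).integrable_of_hasCompactSupport hkc.mul_left)
    (Filter.Eventually.of_forall fun q s _ => ?_)).2
  · rw [norm_mul, Real.norm_of_nonneg (meanKernel_nonneg R q)]
    by_cases hq : koranyi4 q ≤ R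
    · exact mul_le_mul_of_nonneg_right (hC (s, q) ⟨hs, hq⟩) (meanKernel_nonneg R q)
    · have : meanKernel R q = 0 := by
        simp [meanKernel, cutoff, max_eq_left (sub_nonpos.mpr (not_le.mp hq).le)]
      simp [this]
  · refine HasDerivAt.mul_const ?_ _
    have h0 := hasDerivAt_id s
    have h1 : HasDerivAt (fun s => dilTrans p s q)
        (q.1, q.2.1, 2 * s * q.2.2 + 2 * (p.2.1 * q.1 - p.1 * q.2.1)) s := by
      have a1 := (h0.mul_const q.1).const_add p.1
      have a2 := (h0.mul_const q.2.1).const_add p.2.1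
      have a3 := (((h0.pow 2).mul_const q.2.2).const_add p.2.2).add
        ((h0.const_mul 2).mul_const (p.2.1 * q.1 - p.1 * q.2.1))
      exact (a1.prodMk (a2.prodMk a3)).congr_deriv (by simp)
    exact ((hv.differentiable (by simp) _).hasFDerivAt.comp_hasDerivAt s h1)

/-- The mean value property of functions annihilated by the sub-Laplacian. -/
lemma integral_dilTrans_mul_meanKernel {R : ℝ} {v : Heis → ℝ} (hv : ContDiff ℝ (⊤ : ℕ∞) v)
    (hh : ∀ q, subLap v q = 0) (p : Heis) :
    ∫ q, v (dilTrans p 1 q) * meanKernel R q = v p * ∫ q, meanKernel R q := by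
  have hd := hasDerivAt_integral_dilTrans (R := R) hv p
  obtain ⟨r, hr, hr'⟩ := exists_hasDerivAt_eq_slope _ _ zero_lt_one
    (fun s _ => (hd s).continuousAt.continuousWithinAt) (fun s _ => hd s)
  have hz := integral_meanKernel_mul_euler (R := R) (hv.comp (contDiff_dilTrans p r))
    (fun q => by rw [Function.comp_def, subLap_comp_dilTrans hv, hh, mul_zero])
  have hz' : r * ∫ q, fderiv ℝ v (dilTrans p r q)
      (q.1, q.2.1, 2 * r * q.2.2 + 2 * (p.2.1 * q.1 - p.1 * q.2.1)) * meanKernel R q = 0 := by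
    rw [← integral_const_mul, ← hz]
    congr 1 with q
    rw [Function.comp_def, fderiv_comp_dilTrans (hv.differentiable (by simp)), ← mul_assoc,
      fderiv_coords, fderiv_coords v _ (r * _)]
    ring
  have h0 := (mul_eq_zero.mp hz').resolve_left hr.1.ne'
  rw [h0] at hr'
  have h1 : (∫ q, v (dilTrans p 1 q) * meanKernel R q) =
      ∫ q, v (dilTrans p 0 q) * meanKernel R q := by linarith
  rw [h1, ← integral_const_mul]
  simp [dilTrans]

lemma measurePreserving_dilTrans_one (p : Heis) :
    MeasurePreserving (dilTrans p 1) (volume : Measure Heis) volume := by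
  have h2 : ∀ x : ℝ, MeasurePreserving (fun w : ℝ × ℝ =>
      (p.2.1 + w.1, (p.2.2 + 2 * (p.2.1 * x - p.1 * w.1)) + w.2)) volume volume := fun x =>
    (measurePreserving_add_left volume p.2.1).skew_product
      (g := fun y t => (p.2.2 + 2 * (p.2.1 * x - p.1 * y)) + t) (by fun_prop)
      (Filter.Eventually.of_forall fun y => (measurePreserving_add_left volume _).map_eq)
  have h := (measurePreserving_add_left (volume : Measure ℝ) p.1).skew_product
    (g := fun x (w : ℝ × ℝ) => (p.2.1 + w.1, (p.2.2 + 2 * (p.2.1 * x - p.1 * w.1)) + w.2))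
    (by fun_prop) (Filter.Eventually.of_forall fun x => (h2 x).map_eq)
  have e : dilTrans p 1 = fun q : Heis => (p.1 + q.1, p.2.1 + q.2.1,
      (p.2.2 + 2 * (p.2.1 * q.1 - p.1 * q.2.1)) + q.2.2) := by
    funext q
    simp only [dilTrans, Prod.mk.injEq]
    refine ⟨by ring, by ring, by ring⟩
  rw [e]
  exact h

lemma integral_mul_meanKernel_translate {R : ℝ} {v : Heis → ℝ} (hv : ContDiff ℝ (⊤ : ℕ∞) v)
    (hh : ∀ q, subLap v q = 0) (p : Heis) :
    ∫ q, v q * meanKernel R (dilTrans (Hinv p) 1 q) = v p * ∫ q, meanKernel R q := by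
  rw [← integral_dilTrans_mul_meanKernel hv hh p]
  have hp := measurePreserving_dilTrans_one p
  have hc : Continuous fun q => v q * meanKernel R (dilTrans (Hinv p) 1 q) :=
    hv.continuous.mul ((continuous_meanKernel R).comp (contDiff_dilTrans _ 1).continuous)
  have hm := integral_map (μ := volume) hp.measurable.aemeasurable
    (f := fun q => v q * meanKernel R (dilTrans (Hinv p) 1 q)) hc.aestronglyMeasurable
  rw [hp.map_eq] at hm
  rw [hm]
  congr 1 with q
  congr 2
  simp only [dilTrans, Hinv]
  ext <;> simp
  ring

lemma integral_meanKernel_pos : 0 < ∫ q, meanKernel 1 q ∧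
    0 < ∫ q : Heis, (q.1 ^ 2 + q.2.1 ^ 2) * meanKernel 1 q := by
  have hk := continuous_meanKernel 1
  have hkc := hasCompactSupport_meanKernel 1
  have hne : meanKernel 1 (1 / 2, 0, 0) ≠ 0 := by
    norm_num [meanKernel, cutoff, koranyi4]
  refine ⟨hk.integral_pos_of_hasCompactSupport_nonneg_nonzero hkc (meanKernel_nonneg 1) hne,
    Continuous.integral_pos_of_hasCompactSupport_nonneg_nonzero (x := (1 / 2, 0, 0))
      (by fun_prop) hkc.mul_left
      (fun q => mul_nonneg (by positivity) (meanKernel_nonneg 1 q))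
      (mul_ne_zero (by norm_num) hne)⟩

/-- A function with controlled mean value is controlled at some point off the vertical axis. -/
lemma exists_le_off_axis : ∃ δ C : ℝ, 0 < δ ∧ 0 < C ∧ ∀ v : Heis → ℝ, ContDiff ℝ (⊤ : ℕ∞) v →
    (∀ q, subLap v q = 0) → (∀ q, 0 < v q) →
    ∃ q : Heis, koranyi4 q ≤ 1 ∧ δ ≤ q.1 ^ 2 + q.2.1 ^ 2 ∧ v q ≤ C * v 0 := by
  obtain ⟨hK, hJ⟩ := integral_meanKernel_pos
  set K := ∫ q, meanKernel 1 q with hKdef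
  set J := ∫ q : Heis, (q.1 ^ 2 + q.2.1 ^ 2) * meanKernel 1 q with hJdef
  have hk := continuous_meanKernel 1
  have hkc := hasCompactSupport_meanKernel 1
  refine ⟨J / (2 * K), 4 * K / J, by positivity, by positivity, fun v hv hh hpos => ?_⟩
  set δ := J / (2 * K) with hδ
  have hδpos : 0 < δ := by positivity
  by_contra! hcon
  have hmean := integral_dilTrans_mul_meanKernel (R := 1) hv hh 0
  have hid : ∀ q, dilTrans 0 1 q = q := fun q => by simp [dilTrans]
  simp only [hid] at hmean
  have hi1 : Integrable fun q : Heis => (q.1 ^ 2 + q.2.1 ^ 2) * meanKernel 1 q :=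
    Continuous.integrable_of_hasCompactSupport (by fun_prop) hkc.mul_left
  have hi2 : Integrable fun q : Heis => δ * meanKernel 1 q :=
    Continuous.integrable_of_hasCompactSupport (by fun_prop) hkc.mul_left
  have hi3 : Integrable fun q : Heis => v q * meanKernel 1 q :=
    (hv.continuous.mul hk).integrable_of_hasCompactSupport hkc.mul_left
  have hle : ∫ q : Heis, (4 * K / J * v 0) *
      ((q.1 ^ 2 + q.2.1 ^ 2) * meanKernel 1 q - δ * meanKernel 1 q) ≤
      ∫ q, v q * meanKernel 1 q := by
    refine integral_mono ((hi1.sub hi2).const_mul _) hi3 fun q => ?_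
    have hc : 0 < 4 * K / J * v 0 := mul_pos (by positivity) (hpos 0)
    have hkq := meanKernel_nonneg 1 q
    have hvk := mul_nonneg (hpos q).le hkq
    simp only [← sub_mul]
    by_cases hN : koranyi4 q ≤ 1
    · by_cases hz : δ ≤ q.1 ^ 2 + q.2.1 ^ 2
      · have h1 : q.1 ^ 2 + q.2.1 ^ 2 - δ ≤ 1 := by
          have : (q.1 ^ 2 + q.2.1 ^ 2) ^ 2 + q.2.2 ^ 2 ≤ 1 := hN
          nlinarith [sq_nonneg q.2.2]
        have h2 := hcon q hN hz
        have h3 : (q.1 ^ 2 + q.2.1 ^ 2 - δ) * meanKernel 1 q ≤ meanKernel 1 q :=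
          mul_le_of_le_one_left hkq h1
        nlinarith [mul_le_mul_of_nonneg_left h3 hc.le, mul_le_mul_of_nonneg_right h2.le hkq]
      · have h1 : (q.1 ^ 2 + q.2.1 ^ 2 - δ) * meanKernel 1 q ≤ 0 :=
          mul_nonpos_of_nonpos_of_nonneg (by linarith) hkq
        nlinarith [mul_nonneg hc.le (neg_nonneg.mpr h1)]
    · have : meanKernel 1 q = 0 := by
        simp [meanKernel, cutoff, max_eq_left (sub_nonpos.mpr (not_le.mp hN).le)]
      simp [this]
  rw [integral_const_mul, integral_sub hi1 hi2, integral_const_mul, hmean, ← hKdef, ← hJdef] at hle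
  have : 4 * K / J * v 0 * (J - δ * K) = 2 * (v 0 * K) := by
    rw [hδ]; field_simp; ring
  nlinarith [mul_pos (hpos 0) hK]

lemma meanKernel_one_le (q : Heis) : meanKernel 1 q ≤ 1 := by
  have hN : 0 ≤ koranyi4 q := by unfold koranyi4; positivity
  by_cases h : koranyi4 q ≤ 1
  · have h' : (q.1 ^ 2 + q.2.1 ^ 2) ^ 2 + q.2.2 ^ 2 ≤ 1 := h
    have h1 : q.1 ^ 2 + q.2.1 ^ 2 ≤ 1 := by nlinarith [sq_nonneg q.2.2]
    have h2 : cutoff 1 3 q ≤ 1 :=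
      pow_le_one₀ (le_max_left _ _) (max_le zero_le_one (by linarith))
    exact mul_le_one₀ h1 (by unfold cutoff; positivity) h2
  · simp [meanKernel, cutoff, max_eq_left (sub_nonpos.mpr (not_le.mp h).le)]

lemma le_meanKernel {q : Heis} (h : koranyi4 q ≤ 1000) :
    q.1 ^ 2 + q.2.1 ^ 2 ≤ meanKernel 1001 q :=
  le_mul_of_one_le_right (by positivity) (one_le_pow₀ (le_max_of_le_right (by linarith)))

lemma abs_le_one_of_koranyi4_le {q : Heis} (h : koranyi4 q ≤ 1) :
    |q.1| ≤ 1 ∧ |q.2.1| ≤ 1 ∧ |q.2.2| ≤ 1 := by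
  simpa [Prod.norm_def] using norm_le_of_koranyi4_le le_rfl h

lemma koranyi4_le_of_abs_le {q : Heis} (h1 : |q.1| ≤ 3) (h2 : |q.2.1| ≤ 3) (h3 : |q.2.2| ≤ 20) :
    koranyi4 q ≤ 1000 := by
  have e1 := sq_le_sq' (abs_le.mp h1).1 (abs_le.mp h1).2
  have e2 := sq_le_sq' (abs_le.mp h2).1 (abs_le.mp h2).2
  have e3 := sq_le_sq' (abs_le.mp h3).1 (abs_le.mp h3).2
  have : (q.1 ^ 2 + q.2.1 ^ 2) ^ 2 ≤ 18 ^ 2 := pow_le_pow_left₀ (by positivity) (by linarith) 2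
  unfold koranyi4
  linarith

lemma meanKernel_translate_le {p q : Heis} (hp : koranyi4 p ≤ 1) (hq : koranyi4 q ≤ 1) (m : Heis) :
    (q.1 ^ 2 + q.2.1 ^ 2) * meanKernel 1 (dilTrans (Hinv p) 1 m) ≤
      2 * (meanKernel 1001 m + meanKernel 1001 (dilTrans (Hinv q) 1 m)) := by
  set a := dilTrans (Hinv p) 1 m with ha
  have hn1 := meanKernel_nonneg 1001 m
  have hn2 := meanKernel_nonneg 1001 (dilTrans (Hinv q) 1 m)
  by_cases h : koranyi4 a ≤ 1
  · obtain ⟨a1, a2, a3⟩ := abs_le_one_of_koranyi4_le h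
    obtain ⟨p1, p2, p3⟩ := abs_le_one_of_koranyi4_le hp
    obtain ⟨q1, q2, q3⟩ := abs_le_one_of_koranyi4_le hq
    have m1 : m.1 = p.1 + a.1 := by simp [ha, dilTrans, Hinv]
    have m2 : m.2.1 = p.2.1 + a.2.1 := by simp [ha, dilTrans, Hinv]
    have m3 : m.2.2 = p.2.2 + a.2.2 + 2 * (p.2.1 * a.1 - p.1 * a.2.1) := by
      simp [ha, dilTrans, Hinv]; ring
    have b1 : |m.1| ≤ 2 := by rw [m1]; exact (abs_add_le _ _).trans (by linarith)
    have b2 : |m.2.1| ≤ 2 := by rw [m2]; exact (abs_add_le _ _).trans (by linarith)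
    have pr : ∀ {x y c : ℝ}, |x| ≤ 1 → |y| ≤ c → |x * y| ≤ c := fun {x y c} hx hy => by
      rw [abs_mul]
      exact (mul_le_of_le_one_left (abs_nonneg y) hx).trans hy
    have b3 : |m.2.2| ≤ 6 := by
      have c1 := abs_le.mp (pr p2 a1)
      have c2 := abs_le.mp (pr p1 a2)
      have c3 := abs_le.mp p3
      have c4 := abs_le.mp a3
      rw [m3, abs_le]
      constructor <;> linarith
    have hm : koranyi4 m ≤ 1000 :=
      koranyi4_le_of_abs_le (by linarith) (by linarith) (by linarith)
    have hmq : koranyi4 (dilTrans (Hinv q) 1 m) ≤ 1000 := by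
      have c1 := abs_le.mp (pr q2 b1)
      have c2 := abs_le.mp (pr q1 b2)
      have c3 := abs_le.mp q3
      have c4 := abs_le.mp b3
      have c5 := abs_le.mp q1
      have c6 := abs_le.mp q2
      have c7 := abs_le.mp b1
      have c8 := abs_le.mp b2
      refine koranyi4_le_of_abs_le ?_ ?_ ?_ <;> simp only [dilTrans, Hinv] <;> rw [abs_le] <;>
        constructor <;> linarith
    have k1 := le_meanKernel hm
    have k2 := le_meanKernel hmq
    have k3 := mul_le_of_le_one_right (a := q.1 ^ 2 + q.2.1 ^ 2) (by positivity)
      (meanKernel_one_le a)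
    simp only [dilTrans, Hinv] at k2
    simp only [dilTrans, Hinv]
    nlinarith [sq_nonneg (2 * m.1 - q.1), sq_nonneg (2 * m.2.1 - q.2.1)]
  · have : meanKernel 1 a = 0 := by
      simp [meanKernel, cutoff, max_eq_left (sub_nonpos.mpr (not_le.mp h).le)]
    rw [this, mul_zero]
    positivity

lemma exists_harnack_unit_scale : ∃ C : ℝ, 0 < C ∧ ∀ v : Heis → ℝ, ContDiff ℝ (⊤ : ℕ∞) v →
    (∀ q, subLap v q = 0) → (∀ q, 0 < v q) → ∀ p, koranyi4 p ≤ 1 → v p ≤ C * v 0 := by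
  obtain ⟨δ, C, hδ, hC, hoff⟩ := exists_le_off_axis
  obtain ⟨hK, -⟩ := integral_meanKernel_pos
  set K := ∫ q, meanKernel 1 q with hKdef
  set L := ∫ q, meanKernel 1001 q with hLdef
  have hL : 0 ≤ L := integral_nonneg (meanKernel_nonneg 1001)
  refine ⟨2 * L * (1 + C) / (δ * K) + 1, by positivity, fun v hv hh hpos p hp => ?_⟩
  obtain ⟨q, hq, hqδ, hvq⟩ := hoff v hv hh hpos
  have h1 := integral_mul_meanKernel_translate (R := 1) hv hh p
  have h2 := integral_mul_meanKernel_translate (R := 1001) hv hh 0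
  have h3 := integral_mul_meanKernel_translate (R := 1001) hv hh q
  have hid : ∀ q, dilTrans (Hinv 0) 1 q = q := fun q => by simp [dilTrans, Hinv]
  simp only [hid] at h2
  have hint : ∀ R p, Integrable fun q => v q * meanKernel R (dilTrans (Hinv p) 1 q) := by
    intro R p
    have hc := (continuous_meanKernel R).comp (contDiff_dilTrans (Hinv p) 1).continuous
    refine (hv.continuous.mul hc).integrable_of_hasCompactSupport (HasCompactSupport.mul_left ?_)
    refine HasCompactSupport.intro ((isCompact_koranyi4_le R).image
      (contDiff_dilTrans p 1).continuous) fun m hm => ?_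
    have hR : ¬ koranyi4 (dilTrans (Hinv p) 1 m) ≤ R := fun h => hm ⟨_, h, by
      simp only [dilTrans, Hinv]
      ext <;> simp
      ring⟩
    simp [meanKernel, cutoff, max_eq_left (sub_nonpos.mpr (not_le.mp hR).le)]
  have hint0 := hint 1001 0
  simp only [hid] at hint0
  have hle : ∫ m, (q.1 ^ 2 + q.2.1 ^ 2) * (v m * meanKernel 1 (dilTrans (Hinv p) 1 m)) ≤
      ∫ m, 2 * (v m * meanKernel 1001 m + v m * meanKernel 1001 (dilTrans (Hinv q) 1 m)) := by
    refine integral_mono ((hint 1 p).const_mul _) ((hint0.add (hint 1001 q)).const_mul 2)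
      fun m => ?_
    have := mul_le_mul_of_nonneg_left (meanKernel_translate_le hp hq m) (hpos m).le
    simp only
    linarith
  rw [integral_const_mul, integral_const_mul, integral_add hint0 (hint 1001 q), h1, h2, h3] at hle
  have hvK : 0 < v p * K := mul_pos (hpos p) hK
  have h4 : δ * (v p * K) ≤ 2 * L * (1 + C) * v 0 := by
    calc δ * (v p * K) ≤ (q.1 ^ 2 + q.2.1 ^ 2) * (v p * K) :=
          mul_le_mul_of_nonneg_right hqδ hvK.le
      _ ≤ 2 * (v 0 * L + v q * L) := hle
      _ ≤ 2 * (v 0 * L + C * v 0 * L) := by gcongr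
      _ = 2 * L * (1 + C) * v 0 := by ring
  have h5 : v p ≤ 2 * L * (1 + C) / (δ * K) * v 0 := by
    rw [div_mul_eq_mul_div, le_div_iff₀ (by positivity)]
    linarith
  linarith [hpos 0]

/-- Harnack inequality on the whole Heisenberg group. -/
lemma exists_harnack : ∃ C : ℝ, 0 < C ∧ ∀ v : Heis → ℝ, ContDiff ℝ (⊤ : ℕ∞) v →
    (∀ q, subLap v q = 0) → (∀ q, 0 < v q) → ∀ p q, v p ≤ C * v q := by
  obtain ⟨C, hC, h⟩ := exists_harnack_unit_scale
  refine ⟨C, hC, fun v hv hh hpos p q => ?_⟩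
  set b := dilTrans (Hinv q) 1 p with hb
  set s : ℝ := 1 + koranyi4 b with hs
  have hN : 0 ≤ koranyi4 b := by unfold koranyi4; positivity
  have hs1 : 1 ≤ s := by linarith
  have hs0 : s ≠ 0 := by positivity
  have hle : koranyi4 (s⁻¹ * b.1, s⁻¹ * b.2.1, (s ^ 2)⁻¹ * b.2.2) ≤ 1 := by
    have e : koranyi4 (s⁻¹ * b.1, s⁻¹ * b.2.1, (s ^ 2)⁻¹ * b.2.2) = koranyi4 b / s ^ 4 := by
      simp only [koranyi4]
      field_simp
    rw [e, div_le_one (by positivity)]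
    exact (by linarith : koranyi4 b ≤ s).trans (le_self_pow₀ hs1 (by norm_num))
  have key := h (fun m => v (dilTrans q s m)) (hv.comp (contDiff_dilTrans q s))
    (fun m => by rw [subLap_comp_dilTrans hv, hh, mul_zero]) (fun m => hpos _) _ hle
  have e1 : dilTrans q s (s⁻¹ * b.1, s⁻¹ * b.2.1, (s ^ 2)⁻¹ * b.2.2) = p := by
    have f1 : s * (s⁻¹ * b.1) = b.1 := by field_simp
    have f2 : s * (s⁻¹ * b.2.1) = b.2.1 := by field_simp
    have f3 : s ^ 2 * ((s ^ 2)⁻¹ * b.2.2) = b.2.2 := by field_simp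
    have f4 : 2 * s * (q.2.1 * (s⁻¹ * b.1) - q.1 * (s⁻¹ * b.2.1)) =
        2 * (q.2.1 * b.1 - q.1 * b.2.1) := by field_simp
    simp only [dilTrans, f1, f2, f3, f4]
    simp only [hb, dilTrans, Hinv]
    ext <;> simp
    ring
  have e2 : dilTrans q s 0 = q := by simp [dilTrans]
  simpa only [e1, e2] using key

lemma subLap_const_sub (M : ℝ) (u : Heis → ℝ) (p : Heis) :
    subLap (fun q => M - u q) p = -subLap u p := by
  have hX : Xd (fun q => M - u q) = fun q => -1 * Xd u q := by
    funext q; simp [Xd, fderiv_const_sub]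
  have hY : Yd (fun q => M - u q) = fun q => -1 * Yd u q := by
    funext q; simp [Yd, fderiv_const_sub]
  simp only [subLap]
  rw [hX, hY, Xd_const_mul, Yd_const_mul]
  ring

/-- Liouville theorem for functions annihilated by the sub-Laplacian and bounded above. -/
lemma eq_of_subLap_eq_zero_of_bddAbove {u : Heis → ℝ} (hu : ContDiff ℝ (⊤ : ℕ∞) u)
    (hh : ∀ q, subLap u q = 0) (hb : BddAbove (Set.range u)) (p q : Heis) : u p = u q := by
  obtain ⟨C, hC, harnack⟩ := exists_harnack
  set M := sSup (Set.range u) with hM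
  have hle : ∀ q, u q ≤ M := fun q => le_csSup hb ⟨q, rfl⟩
  have hMu : ∀ p, u p = M := by
    intro p
    refine le_antisymm (hle p) (le_of_forall_pos_le_add fun ε hε => ?_)
    obtain ⟨_, ⟨q, rfl⟩, hq⟩ := exists_lt_of_lt_csSup (Set.range_nonempty u)
      (sub_lt_self M (show 0 < ε / (2 * C) by positivity))
    have hη : 0 < ε / (2 * C) := by positivity
    have h := harnack (fun m => (M + ε / (2 * C)) - u m) (contDiff_const.sub hu)
      (fun m => by rw [subLap_const_sub, hh, neg_zero])
      (fun m => by have := hle m; linarith) p q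
    have h2 : C * ((M + ε / (2 * C)) - u q) ≤ C * (2 * (ε / (2 * C))) :=
      mul_le_mul_of_nonneg_left (by linarith) hC.le
    have h3 : C * (2 * (ε / (2 * C))) = ε := by field_simp
    linarith
  rw [hMu p, hMu q]

lemma lt_rho_of_lt_koranyi4 {R : ℝ} (hR : 0 < R) {q : Heis} (h : R ^ 4 < koranyi4 q) :
    R < rho q := by
  have := Real.rpow_lt_rpow (by positivity) h (show (0 : ℝ) < 1 / 4 by norm_num)
  rwa [← Real.rpow_natCast, ← Real.rpow_mul hR.le, show ((4 : ℕ) : ℝ) * (1 / 4) = 1 by norm_num,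
    Real.rpow_one] at this

/-- Liouville-type theorem. If `Δ_b(Δ_b w) = 0` on all of `ℍ¹` and
`Δ_b w` has nonpositive limsup at infinity, then `Δ_b w` is a constant `≤ 0`. -/
theorem subLap_const_of_biharmonic_of_nonpos_at_infinity
    (w : Heis → ℝ) (hw : ContDiff ℝ (⊤ : ℕ∞) w)
    (hbi : ∀ p, subLap (subLap w) p = 0)
    (hlim : ∀ ε : ℝ, 0 < ε → ∃ R : ℝ, 0 < R ∧ ∀ p : Heis, R < rho p → subLap w p ≤ ε) :
    ∃ c : ℝ, c ≤ 0 ∧ ∀ p, subLap w p = c := by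
  set u := subLap w with hu
  have hsm : ContDiff ℝ (⊤ : ℕ∞) u := contDiff_subLap hw
  have hb : BddAbove (Set.range u) := by
    obtain ⟨R, hR, hRu⟩ := hlim 1 one_pos
    obtain ⟨M, hM⟩ := (isCompact_koranyi4_le (R ^ 4)).bddAbove_image hsm.continuous.continuousOn
    refine ⟨max M 1, ?_⟩
    rintro _ ⟨q, rfl⟩
    by_cases hq : koranyi4 q ≤ R ^ 4
    · exact (hM ⟨q, hq, rfl⟩).trans (le_max_left _ _)
    · exact (hRu q (lt_rho_of_lt_koranyi4 hR (not_le.mp hq))).trans (le_max_right _ _)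
  have hconst := fun p => eq_of_subLap_eq_zero_of_bddAbove hsm hbi hb p 0
  refine ⟨u 0, le_of_forall_pos_le_add fun ε hε => ?_, hconst⟩
  obtain ⟨R, hR, hRu⟩ := hlim ε hε
  have hfar : R < rho (R + 1, 0, 0) := by
    refine lt_rho_of_lt_koranyi4 hR ?_
    have h4 : koranyi4 (R + 1, 0, 0) = (R + 1) ^ 4 := by simp only [koranyi4]; ring
    rw [h4]
    exact pow_lt_pow_left₀ (by linarith) hR.le (by norm_num)
  rw [zero_add, ← hconst (R + 1, 0, 0)]
  exact hRu _ hfar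

end
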